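/- Let ℓ ≥ 2 and r ≥ 1 be integers, h, k coprime with Q = gcd(k, ℓ), h' and h_Q integers with h·h' ≡ −1 (mod k) and (ℓ/Q)·h·h_Q ≡ −1 (mod k/Q), and Re(z) > 0. Then R(q) = (∏_{n≥1}(1−q^{ℓn})/(1−q^n))^r satisfies R(e^{2πi(h/k + iz/k²)}) = (Q/ℓ)^{r/2} · e^{iπr(s(h,k) − s(ℓh/Q, k/Q)) + (πr/(12z))(1 − Q²/ℓ) + (πrz/(12k²))(ℓ−1)} · F(e^{2πi(h'/k + i/z)}) / F(e^{2πiQ(h_Q/k + iQ/(ℓz))}), where F(q) = ∏_{n≥1}(1−q^n)^{−r}. -/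

import Mathlib

open Finset Complex

/-- The Dedekind sum `s(h,k) = ∑_{r=1}^{k-1} (r/k)·(hr/k − ⌊hr/k⌋ − 1/2)`. -/
noncomputable def dedekindSum (h : ℤ) (k : ℕ) : ℝ :=
  ∑ r ∈ Finset.Ico 1 k, ((r : ℝ) / k) *
    (((h * r : ℤ) : ℝ) / k - ⌊((h * r : ℤ) : ℝ) / k⌋ - 1 / 2)

/-- The Euler partition generating function `f(q) = ∏_{n≥1} (1 − qⁿ)⁻¹`. -/
noncomputable def fEuler (q : ℂ) : ℂ := (∏' n : ℕ, (1 - q ^ (n + 1)))⁻¹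

/-- `R(q) = (∏_{n≥1} (1 − q^{ℓn})/(1 − qⁿ))^r`, the generating function of
`r`-colored `ℓ`-regular partitions. -/
noncomputable def Rgen (r ℓ : ℕ) (q : ℂ) : ℂ :=
  (∏' n : ℕ, (1 - q ^ (ℓ * (n + 1))) / (1 - q ^ (n + 1))) ^ r


lemma ds_perm (k h : ℕ) (hh : 0 < h) (hc : Nat.Coprime k h) (g : ℕ → ℝ) :
    ∑ s ∈ range h, g (k * s % h) = ∑ s ∈ range h, g s := by
  have hmaps : Set.MapsTo (fun s => k * s % h) (range h : Set ℕ) (range h : Set ℕ) := by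
    intro s _
    simpa using Nat.mod_lt _ hh
  have hinj : Set.InjOn (fun s => k * s % h) (range h : Set ℕ) := by
    intro a ha b hb hab
    have h1 : k * a ≡ k * b [MOD h] := hab
    have h2 : a ≡ b [MOD h] := Nat.ModEq.cancel_left_of_coprime (by simpa [Nat.gcd_comm] using hc) h1
    exact Nat.ModEq.eq_of_lt_of_lt h2 (by simpa using ha) (by simpa using hb)
  refine Finset.sum_nbij (fun s => k * s % h) (fun s hs => hmaps hs) hinj
    (Finset.surjOn_of_injOn_of_card_le _ hmaps hinj le_rfl) (fun _ _ => rfl)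

lemma ds_sum1 (n : ℕ) : ∑ s ∈ range n, (s : ℝ) = n * (n - 1) / 2 := by
  induction n with
  | zero => simp
  | succ n ih => rw [sum_range_succ, ih]; push_cast; ring

lemma ds_sum2 (n : ℕ) : ∑ s ∈ range n, (s : ℝ) ^ 2 = n * (n - 1) * (2 * n - 1) / 6 := by
  induction n with
  | zero => simp
  | succ n ih => rw [sum_range_succ, ih]; push_cast; ring

lemma ds_mod (a h : ℕ) : ((a % h : ℕ) : ℝ) = a - h * (a / h : ℕ) := by
  have := Nat.mod_add_div a h
  have h2 : ((a % h : ℕ) : ℝ) + h * (a / h : ℕ) = a := by exact_mod_cast this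
  linarith

lemma ds_floor1 (k h : ℕ) (hh : 0 < h) (hc : Nat.Coprime k h) :
    ∑ s ∈ range h, ((k * s / h : ℕ) : ℝ) = (h - 1) * (k - 1) / 2 := by
  have h1 := ds_perm k h hh hc (fun x => (x : ℝ))
  simp only [ds_mod, sum_sub_distrib, ← mul_sum, Nat.cast_mul, ds_sum1] at h1
  have : (h : ℝ) ≠ 0 := by positivity
  apply mul_left_cancel₀ this
  linarith

lemma ds_floor2 (k h : ℕ) (hh : 0 < h) (hc : Nat.Coprime k h) :
    (h : ℝ) ^ 2 * ∑ s ∈ range h, ((k * s / h : ℕ) : ℝ) ^ 2 =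
      2 * k * h * ∑ s ∈ range h, (s : ℝ) * ((k * s / h : ℕ) : ℝ)
       + (1 - k ^ 2) * (h * (h - 1) * (2 * h - 1) / 6) := by
  have h1 := ds_perm k h hh hc (fun x => (x : ℝ) ^ 2)
  rw [ds_sum2] at h1
  have h2 : ∑ s ∈ range h, ((k * s % h : ℕ) : ℝ) ^ 2 =
     k ^ 2 * ∑ s ∈ range h, (s : ℝ) ^ 2 - 2 * k * h * ∑ s ∈ range h, (s : ℝ) * ((k * s / h : ℕ) : ℝ)
      + (h : ℝ) ^ 2 * ∑ s ∈ range h, ((k * s / h : ℕ) : ℝ) ^ 2 := by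
    rw [mul_sum, mul_sum, mul_sum, ← sum_sub_distrib, ← sum_add_distrib]
    refine sum_congr rfl fun s _ => ?_
    rw [ds_mod]; push_cast; ring
  rw [h2, ds_sum2] at h1
  linarith

lemma ds_lattice (k h : ℕ) (hk : 0 < k) (hh : 0 < h) (hc : Nat.Coprime k h) :
    ∑ r ∈ range k, (r : ℝ) * ((h * r / k : ℕ) : ℝ) =
     ∑ s ∈ range h, ((k : ℝ) * (k - 1) / 2 - ((k * s / h : ℕ) : ℝ) * ((k * s / h : ℕ) + 1) / 2)
      - k * (k - 1) / 2 := by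
  have e1 : ∀ r ∈ range k, (r : ℝ) * ((h * r / k : ℕ) : ℝ) =
      ∑ s ∈ Ico 1 h, if k * s ≤ h * r then (r : ℝ) else 0 := by
    intro r hr
    rw [← sum_filter, sum_const, nsmul_eq_mul, mul_comm]
    congr 2
    have : (Ico 1 h).filter (fun s => k * s ≤ h * r) = Ico 1 (h * r / k + 1) := by
      ext s
      simp only [mem_filter, mem_Ico, Nat.lt_succ_iff]
      rw [Nat.le_div_iff_mul_le hk, mul_comm s k]
      constructor
      · rintro ⟨⟨a, b⟩, c⟩; exact ⟨a, c⟩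
      · rintro ⟨a, c⟩
        refine ⟨⟨a, ?_⟩, c⟩
        have hr' : r < k := by simpa using hr
        by_contra hcon
        push Not at hcon
        nlinarith
    rw [this]; simp
  rw [sum_congr rfl e1, sum_comm]
  have e2 : ∀ s ∈ Ico 1 h, (∑ r ∈ range k, if k * s ≤ h * r then (r : ℝ) else 0) =
      (k : ℝ) * (k - 1) / 2 - ((k * s / h : ℕ) : ℝ) * ((k * s / h : ℕ) + 1) / 2 := by
    intro s hs
    rw [mem_Ico] at hs
    have e3 : ∀ r ∈ range k, (if k * s ≤ h * r then (r : ℝ) else 0) =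
        r - if r < k * s / h + 1 then (r : ℝ) else 0 := by
      intro r _
      have hne : h * r ≠ k * s := by
        intro he
        have : h ∣ k * s := ⟨r, he.symm⟩
        have := Nat.le_of_dvd (by omega) ((Nat.Coprime.symm hc).dvd_of_dvd_mul_left this)
        omega
      have : r < k * s / h + 1 ↔ h * r ≤ k * s := by
        rw [Nat.lt_succ_iff, Nat.le_div_iff_mul_le hh, mul_comm]
      simp only [this]
      by_cases hx : k * s ≤ h * r
      · rw [if_pos hx, if_neg (by omega)]; simp
      · rw [if_neg hx, if_pos (by omega)]; simp
    have hlt : k * s / h < k := by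
      rw [Nat.div_lt_iff_lt_mul hh]; exact Nat.mul_lt_mul_of_pos_left hs.2 hk
    rw [sum_congr rfl e3, sum_sub_distrib, ds_sum1, ← sum_filter]
    have : (range k).filter (fun r => r < k * s / h + 1) = range (k * s / h + 1) := by
      ext r; simp only [mem_filter, mem_range]; omega
    rw [this, ds_sum1]; push_cast; ring
  rw [sum_congr rfl e2, range_eq_Ico, sum_eq_sum_Ico_succ_bot hh]
  simp

lemma ds_nat (h k : ℕ) (hk : 0 < k) : dedekindSum (h : ℤ) k =
    ∑ r ∈ range k, ((r : ℝ) / k) * ((h * r : ℝ) / k - ((h * r / k : ℕ) : ℝ) - 1 / 2) := by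
  rw [range_eq_Ico, sum_eq_sum_Ico_succ_bot hk]
  simp only [Nat.cast_zero, zero_div, zero_mul, zero_add, dedekindSum]
  refine sum_congr rfl fun r _ => ?_
  have : ⌊(((h : ℤ) * r : ℤ) : ℝ) / k⌋ = ((h * r / k : ℕ) : ℤ) := by
    have := Nat.floor_div_eq_div (K := ℝ) (h * r) k
    rw [← this, Int.natCast_floor_eq_floor (by positivity)]
    push_cast; rfl
  rw [this]; simp only [Int.cast_mul, Int.cast_natCast]

lemma ds_expand (h k : ℕ) (hk : 0 < k) : dedekindSum (h : ℤ) k =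
    h * ((k : ℝ) - 1) * (2 * k - 1) / (6 * k) - (∑ r ∈ range k, (r : ℝ) * ((h * r / k : ℕ) : ℝ)) / k
      - ((k : ℝ) - 1) / 4 := by
  rw [ds_nat h k hk]
  have hk' : (k : ℝ) ≠ 0 := by positivity
  have : ∑ r ∈ range k, ((r : ℝ) / k) * ((h * r : ℝ) / k - ((h * r / k : ℕ) : ℝ) - 1 / 2) =
     (h / k ^ 2) * ∑ r ∈ range k, (r : ℝ) ^ 2 -
      (∑ r ∈ range k, (r : ℝ) * ((h * r / k : ℕ) : ℝ)) / k - (1 / (2 * k)) * ∑ r ∈ range k, (r : ℝ) := by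
    rw [mul_sum, mul_sum, sum_div, ← sum_sub_distrib, ← sum_sub_distrib]
    refine sum_congr rfl fun r _ => ?_
    field_simp
  rw [this, ds_sum1, ds_sum2]
  field_simp
  ring

lemma ds_recip (h k : ℕ) (hh : 0 < h) (hk : 0 < k) (hc : Nat.Coprime h k) :
    dedekindSum (h : ℤ) k + dedekindSum (k : ℤ) h =
      -1 / 4 + ((h : ℝ) / k + k / h + 1 / (h * k)) / 12 := by
  rw [ds_expand h k hk, ds_expand k h hh]
  have a := ds_lattice k h hk hh hc.symm
  have b := ds_floor1 k h hh hc.symm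
  have c := ds_floor2 k h hh hc.symm
  have a2 : ∑ s ∈ range h, ((k : ℝ) * (k - 1) / 2 - ((k * s / h : ℕ) : ℝ) * ((k * s / h : ℕ) + 1) / 2)
     = h * (k * (k - 1) / 2) - (∑ s ∈ range h, ((k * s / h : ℕ) : ℝ) ^ 2) / 2
       - (∑ s ∈ range h, ((k * s / h : ℕ) : ℝ)) / 2 := by
    rw [sum_div, sum_div, sum_sub_distrib, sub_sub, ← sum_add_distrib, sum_const, card_range,
      nsmul_eq_mul]
    congr 1
    refine sum_congr rfl fun r _ => ?_
    ring
  rw [a2, b] at a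
  rw [a]
  generalize (∑ s ∈ range h, ((k * s / h : ℕ) : ℝ) ^ 2) = X at *
  generalize (∑ s ∈ range h, (s : ℝ) * ((k * s / h : ℕ) : ℝ)) = Y at *
  have hk' : (k : ℝ) ≠ 0 := by positivity
  have hh' : (h : ℝ) ≠ 0 := by positivity
  have : Y = ((h : ℝ) ^ 2 * X - (1 - k ^ 2) * (h * (h - 1) * (2 * h - 1) / 6)) / (2 * k * h) := by
    rw [eq_div_iff (by positivity)]; linarith
  rw [this]
  field_simp
  ring

lemma ds_periodic (h m : ℤ) (k : ℕ) (hk : 0 < k) : dedekindSum (h + k * m) k = dedekindSum h k := by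
  unfold dedekindSum
  refine sum_congr rfl fun r _ => ?_
  have hk' : (k : ℝ) ≠ 0 := by positivity
  have : (((h + k * m) * r : ℤ) : ℝ) / k = ((h * r : ℤ) : ℝ) / k + ((m * r : ℤ) : ℝ) := by
    push_cast; field_simp
  rw [this, Int.floor_add_intCast]; push_cast; ring

lemma ds_sum_mod (h k : ℕ) (hk : 0 < k) (hc : Nat.Coprime h k) (r : ℕ) (hr : r ∈ Ico 1 k) :
    ⌊((-h * r : ℤ) : ℝ) / k⌋ = -⌊((h * r : ℤ) : ℝ) / k⌋ - 1 := by
  have hk' : (0 : ℝ) < k := by positivity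
  rw [Int.floor_eq_iff]
  set n := ⌊((h * r : ℤ) : ℝ) / k⌋ with hn
  have h1 := Int.floor_le (((h * r : ℤ) : ℝ) / k)
  have h2 := Int.lt_floor_add_one (((h * r : ℤ) : ℝ) / k)
  rw [← hn] at h1 h2
  have hne : (n : ℝ) ≠ ((h * r : ℤ) : ℝ) / k := by
    intro he
    rw [eq_div_iff hk'.ne'] at he
    have he' : n * k = h * r := by exact_mod_cast he
    have : (k : ℤ) ∣ ((h * r : ℕ) : ℤ) := ⟨n, by push_cast; linarith⟩
    have h3 : k ∣ h * r := by exact_mod_cast this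
    rw [mem_Ico] at hr
    have := Nat.le_of_dvd (by omega) (hc.symm.dvd_of_dvd_mul_left h3)
    omega
  have h4 := lt_of_le_of_ne h1 hne
  have h5 : ((-h * r : ℤ) : ℝ) / k = - (((h * r : ℤ) : ℝ) / k) := by push_cast; ring
  rw [h5]; push_cast at *
  constructor <;> linarith

lemma ds_neg (h k : ℕ) (hk : 0 < k) (hc : Nat.Coprime h k) :
    dedekindSum (-h : ℤ) k = - dedekindSum h k := by
  unfold dedekindSum
  rw [← sum_neg_distrib]
  refine sum_congr rfl fun r hr => ?_
  rw [ds_sum_mod h k hk hc r hr]; push_cast; ring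

lemma csqrt_eq_exp_half {z : ℂ} (hz : z ≠ 0) : Complex.sqrt z = Complex.exp (log z / 2) := by
  unfold Complex.sqrt
  rw [Complex.cpow_def_of_ne_zero hz]; rfl

/-- `fEuler` as a function of the upper half-plane variable. -/
noncomputable def GE (τ : ℂ) : ℂ := fEuler (cexp (2 * Real.pi * I * τ))

lemma GE_add_int (τ : ℂ) (m : ℤ) : GE (τ + m) = GE τ := by
  unfold GE
  congr 1
  rw [Complex.exp_eq_exp_iff_exists_int]
  exact ⟨m, by ring⟩

lemma eta_eq_GE (τ : ℂ) : ModularForm.eta τ = cexp (Real.pi * I * τ / 12) * (GE τ)⁻¹ := by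
  unfold ModularForm.eta GE fEuler
  rw [inv_inv]
  congr 1
  · unfold Function.Periodic.qParam
    congr 1; push_cast; ring
  · simp only [ModularForm.eta_q_eq_pow]

lemma GE_ne_zero {τ : ℂ} (h : 0 < τ.im) : GE τ ≠ 0 := by
  intro h0
  have := ModularForm.eta_ne_zero (z := τ) h
  rw [eta_eq_GE, h0] at this
  simp at this

lemma log_I_mul (u : ℂ) (hu : 0 < u.re) : log (I * u) = log I + log u := by
  have hu0 : u ≠ 0 := by rintro rfl; simp at hu
  apply Complex.log_mul I_ne_zero hu0
  have := abs_lt.mp (Complex.abs_arg_lt_pi_div_two_iff.mpr (Or.inl hu))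
  rw [arg_I]
  constructor <;> linarith [this.1, this.2, Real.pi_pos]

lemma GE_S (u : ℂ) (hu : 0 < u.re) :
    GE (I * u) = cexp (log u / 2 + Real.pi / 12 * (1 / u - u)) * GE (I / u) := by
  have hu0 : u ≠ 0 := by rintro rfl; simp at hu
  have him : 0 < (I * u).im := by simpa using hu
  have hS := ModularForm.eta_comp_eq_csqrt_I_inv (show I * u ∈ UpperHalfPlane.upperHalfPlaneSet from him)
  have e : -1 / (I * u) = I / u := by
    field_simp; simp
  have him2 : 0 < (I / u).im := by
    have : I / u = I * u⁻¹ := rfl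
    rw [this]
    have := Complex.inv_re u
    simp [this]
    exact div_pos hu (Complex.normSq_pos.mpr hu0)
  simp only [Function.comp, Pi.smul_apply, Pi.mul_apply, smul_eq_mul, e] at hS
  have hs : (Complex.sqrt I)⁻¹ * Complex.sqrt (I * u) = cexp (log u / 2) := by
    rw [csqrt_eq_exp_half I_ne_zero, csqrt_eq_exp_half (mul_ne_zero I_ne_zero hu0), log_I_mul u hu,
      ← Complex.exp_neg, ← Complex.exp_add]
    congr 1; ring
  rw [← mul_assoc, hs, eta_eq_GE, eta_eq_GE] at hS
  have g1 := GE_ne_zero him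
  have g2 := GE_ne_zero him2
  have h3 : cexp (Real.pi * I * (I / u) / 12) * GE (I * u) =
      cexp (log u / 2) * cexp (Real.pi * I * (I * u) / 12) * GE (I / u) := by
    generalize cexp (Real.pi * I * (I / u) / 12) = E1 at hS ⊢
    generalize cexp (Real.pi * I * (I * u) / 12) = E2 at hS ⊢
    generalize cexp (log u / 2) = E3 at hS ⊢
    field_simp at hS
    rw [hS]; ring
  have h4 : GE (I * u) = cexp (-(Real.pi * I * (I / u) / 12)) *
      (cexp (log u / 2) * cexp (Real.pi * I * (I * u) / 12) * GE (I / u)) := by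
    rw [← h3, ← mul_assoc, ← Complex.exp_add]; simp
  rw [h4, ← mul_assoc, ← Complex.exp_add, ← Complex.exp_add]
  congr 2
  field_simp
  linear_combination (-2 * Real.pi * (1 - u ^ 2)) * I_sq

lemma GE_main (k : ℕ) : ∀ (_ : 0 < k) (h h' : ℤ) (_ : h * h' ≡ -1 [ZMOD (k : ℤ)]) (w : ℂ)
    (_ : 0 < w.re), GE ((h + I * w) / k) =
      cexp (Real.pi * I * (dedekindSum h k : ℝ) + log w / 2 + Real.pi / (12 * k) * (1 / w - w)) *
        GE ((h' + I / w) / k) := by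
  induction k using Nat.strong_induction_on with
  | _ k ih =>
  intro hk h h' hh w hw
  have hw0 : w ≠ 0 := by rintro rfl; simp at hw
  rcases Nat.eq_or_lt_of_le (Nat.succ_le_of_lt hk) with h1 | h1
  · have hk1 : k = 1 := h1.symm
    subst hk1
    have hd : dedekindSum h 1 = 0 := by simp [dedekindSum]
    rw [hd]
    simp only [Nat.cast_one, div_one]
    rw [add_comm, GE_add_int, add_comm (h' : ℂ), GE_add_int, GE_S w hw]
    simp
  · -- reduce modulo `k`
    have hkZ : (0 : ℤ) < k := by exact_mod_cast hk
    obtain ⟨b, hb⟩ := Int.eq_ofNat_of_zero_le (Int.emod_nonneg h hkZ.ne')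
    have hbk : b < k := by
      have := Int.emod_lt_of_pos h hkZ
      rw [hb] at this; exact_mod_cast this
    have hdecomp : h = (b : ℤ) + k * (h / k) := by
      have := Int.emod_add_mul_ediv h k
      rw [hb] at this; simpa using this.symm
    have hbm : (b : ℤ) * h' ≡ -1 [ZMOD (k : ℤ)] := by
      refine Int.ModEq.trans (Int.ModEq.mul_right _ ?_) hh
      rw [Int.modEq_iff_dvd]; exact ⟨h / k, by linarith⟩
    obtain ⟨c, hc⟩ := (Int.modEq_iff_dvd.mp hbm)
    have hbpos : 0 < b := by
      rcases Nat.eq_zero_or_pos b with h0 | h0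
      · subst h0
        have : (k : ℤ) ∣ 1 := ⟨-c, by simp at hc; linarith⟩
        have := Int.le_of_dvd one_pos this
        omega
      · exact h0
    have hcop : Nat.Coprime b k := by
      rw [← Nat.isCoprime_iff_coprime]
      exact ⟨-h', -c, by linarith⟩
    have hds : dedekindSum h k = dedekindSum b k := by
      conv_lhs => rw [hdecomp]
      exact ds_periodic _ _ _ hk
    have hrec := ds_recip b k hbpos hk hcop
    have hneg := ds_neg k b hbpos hcop.symm
    have hkC : (k : ℂ) ≠ 0 := by exact_mod_cast hk.ne'
    have hbC : (b : ℂ) ≠ 0 := by exact_mod_cast hbpos.ne'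
    have hbR : (0 : ℝ) < b := by exact_mod_cast hbpos
    have hkR : (0 : ℝ) < k := by exact_mod_cast hk
    have e1 : GE ((h + I * w) / k) = GE ((b + I * w) / k) := by
      rw [← GE_add_int ((b + I * w) / k) (h / k)]
      congr 1
      have : (h : ℂ) = b + k * (h / k : ℤ) := by exact_mod_cast congrArg (Int.cast : ℤ → ℂ) hdecomp
      rw [this]; field_simp; ring
    -- the two auxiliary points of the right half-plane
    set u : ℂ := (w - I * b) / k with hu
    have hure : 0 < u.re := by
      have : u.re = w.re / k := by rw [hu, Complex.div_natCast_re]; simp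
      rw [this]; positivity
    have hu0 : u ≠ 0 := by rintro h0; rw [h0] at hure; simp at hure
    have hwb : w - I * b ≠ 0 := by
      intro h0; apply hu0; rw [hu, h0]; simp
    set v : ℂ := (b / w + I) / k with hv
    have hvre : 0 < v.re := by
      have h2 : v = (b : ℝ) * w⁻¹ / k + I / k := by rw [hv]; push_cast; ring
      have : v.re = b * (w⁻¹).re / k := by
        rw [h2, add_re, Complex.div_natCast_re, Complex.div_natCast_re, Complex.re_ofReal_mul]; simp
      rw [this, Complex.inv_re]
      have := Complex.normSq_pos.mpr hw0
      positivity
    have hv0 : v ≠ 0 := by rintro h0; rw [h0] at hvre; simp at hvre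
    have hvire : 0 < (v⁻¹).re := by
      rw [Complex.inv_re]; exact div_pos hvre (Complex.normSq_pos.mpr hv0)
    have hvu : v * w = I * u := by
      rw [hv, hu]; field_simp; linear_combination (b : ℂ) * I_sq
    have hI2 : I ^ 2 = -1 := I_sq
    have e2 : ((b : ℂ) + I * w) / k = I * u := by
      rw [hu]; field_simp; linear_combination (b : ℂ) * I_sq
    have e3 : I / u = (((-k : ℤ) : ℂ) + I * v⁻¹) / b := by
      have hvinv : v⁻¹ = w / (I * u) := by rw [← hvu]; field_simp
      rw [hvinv]
      have hku : (k : ℂ) * u = w - I * b := by rw [hu]; field_simp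
      push_cast
      field_simp
      linear_combination (1 : ℂ) * hku
    have hmod : (-k : ℤ) * (-c) ≡ -1 [ZMOD (b : ℤ)] := by
      rw [Int.modEq_iff_dvd]; exact ⟨h', by linarith⟩
    have hih := ih b hbk hbpos (-k) (-c) hmod v⁻¹ hvire
    have e4 : (((-c : ℤ) : ℂ) + I / v⁻¹) / b = (h' + I / w) / k := by
      have hcC : -1 - (b : ℂ) * h' = k * c := by exact_mod_cast congrArg (Int.cast : ℤ → ℂ) hc
      rw [div_inv_eq_mul, hv]; push_cast
      field_simp
      linear_combination w * hcC + w * hI2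
    have hlog : log u + log v⁻¹ = log w - log I := by
      have h5 : log v⁻¹ = - log v := by
        apply Complex.log_inv
        have := abs_lt.mp (Complex.abs_arg_lt_pi_div_two_iff.mpr (Or.inl hvre))
        linarith [this.2, Real.pi_pos]
      have h6 : log (v * w) = log v + log w := by
        apply Complex.log_mul hv0 hw0
        have := abs_lt.mp (Complex.abs_arg_lt_pi_div_two_iff.mpr (Or.inl hvre))
        have := abs_lt.mp (Complex.abs_arg_lt_pi_div_two_iff.mpr (Or.inl hw))
        constructor <;> linarith
      rw [hvu, log_I_mul u hure] at h6
      rw [h5]; linear_combination h6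
    rw [e1, e2, GE_S u hure, e3, hih, e4, ← mul_assoc, ← Complex.exp_add, hds]
    congr 2
    have hdsC : ((dedekindSum (-k : ℤ) b : ℝ) : ℂ) = (dedekindSum b k : ℝ) + 1 / 4 -
        ((b : ℂ) / k + k / b + 1 / (b * k)) / 12 := by
      have : dedekindSum (-k : ℤ) b = dedekindSum b k + 1 / 4 -
        ((b : ℝ) / k + k / b + 1 / (b * k)) / 12 := by rw [hneg]; linarith
      rw [this]; push_cast; ring
    rw [hdsC]
    rw [log_I] at hlog
    have hv1 : 1 / v⁻¹ = (b / w + I) / k := by rw [hv]; simp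
    have hu1 : 1 / u = -I * (((-k : ℤ) : ℂ) + I * v⁻¹) / b := by
      rw [mul_div_assoc, ← e3]; field_simp; linear_combination hI2
    have : (Real.pi : ℂ) / 12 * (1 / u - u) + Real.pi / (12 * b) * (1 / v⁻¹ - v⁻¹) =
       Real.pi * I * (((b : ℂ) / k + k / b + 1 / (b * k)) / 12) + Real.pi / (12 * k) * (1 / w - w) := by
      rw [hv1, hu1, hu]; push_cast
      generalize v⁻¹ = y
      field_simp
      ring_nf
      simp only [hI2]
      ring
    linear_combination this + hlog / 2

lemma Rgen_eq (r ℓ : ℕ) (hℓ : 2 ≤ ℓ) (q : ℂ) (hq : ‖q‖ < 1) :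
    Rgen r ℓ q = (fEuler q / fEuler (q ^ ℓ)) ^ r := by
  unfold Rgen fEuler
  congr 1
  have hq2 : ‖q ^ ℓ‖ < 1 := by
    rw [norm_pow]; exact pow_lt_one₀ (norm_nonneg _) hq (by omega)
  have m1 := ModularForm.multipliable_one_sub_pow hq
  have m2 := ModularForm.multipliable_one_sub_pow hq2
  simp only [pow_mul]
  have hne : ∏' n : ℕ, (1 - q ^ (n + 1)) ≠ 0 := by
    have hs : Summable fun n : ℕ => ‖-q ^ (n + 1)‖ := by
      simpa using (summable_nat_add_iff 1).mpr (summable_geometric_of_lt_one (norm_nonneg _) hq)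
    have := tprod_one_add_ne_zero_of_summable (f := fun n : ℕ => -q ^ (n + 1)) ?_ hs
    · simpa [sub_eq_add_neg] using this
    · intro n h0
      have h1 : q ^ (n + 1) = 1 := by linear_combination -h0
      have h2 : ‖q‖ ^ (n + 1) < 1 := pow_lt_one₀ (norm_nonneg _) hq (by omega)
      rw [← norm_pow, h1] at h2
      simp at h2
  have hp := m2.hasProd.div₀ m1.hasProd hne
  rw [hp.tprod_eq]
  field_simp

/-- The transformation formula for the generating function of `r`-colored
`ℓ`-regular partitions, where `F(q) = ∏_{n≥1}(1−qⁿ)^{−r}` is `fEuler q ^ r`. -/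
theorem Rgen_transformation (r ℓ h k : ℕ) (hr : 1 ≤ r) (hℓ : 2 ≤ ℓ) (hk : 0 < k)
    (hcop : Nat.Coprime h k) (Q : ℕ) (hQ : Q = Nat.gcd k ℓ) (h' h_Q : ℤ)
    (hch : (h : ℤ) * h' ≡ -1 [ZMOD (k : ℤ)])
    (hcQ : ((ℓ / Q : ℕ) : ℤ) * (h : ℤ) * h_Q ≡ -1 [ZMOD ((k / Q : ℕ) : ℤ)])
    (z : ℂ) (hz : 0 < z.re) :
    Rgen r ℓ (Complex.exp (2 * (Real.pi : ℂ) * Complex.I *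
        ((h : ℂ) / k + Complex.I * z / (k : ℂ) ^ 2))) =
      ((Q : ℂ) / ℓ) ^ ((r : ℂ) / 2) *
        Complex.exp ((Real.pi : ℂ) * Complex.I * r *
            (((dedekindSum h k : ℝ) : ℂ) -
              ((dedekindSum ((ℓ / Q : ℕ) * (h : ℤ)) (k / Q) : ℝ) : ℂ)) +
          (Real.pi : ℂ) * r / (12 * z) * (1 - (Q : ℂ) ^ 2 / ℓ) +
          (Real.pi : ℂ) * r * z / (12 * (k : ℂ) ^ 2) * ((ℓ : ℂ) - 1)) *
        (fEuler (Complex.exp (2 * (Real.pi : ℂ) * Complex.I *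
            ((h' : ℂ) / k + Complex.I / z)))) ^ r /
        (fEuler (Complex.exp (2 * (Real.pi : ℂ) * Complex.I * (Q : ℂ) *
            ((h_Q : ℂ) / k + Complex.I * Q / ((ℓ : ℂ) * z))))) ^ r := by
  have hQpos : 0 < Q := by rw [hQ]; exact Nat.gcd_pos_of_pos_left _ hk
  obtain ⟨k1, hk1⟩ : Q ∣ k := by rw [hQ]; exact Nat.gcd_dvd_left _ _
  obtain ⟨l1, hl1⟩ : Q ∣ ℓ := by rw [hQ]; exact Nat.gcd_dvd_right _ _
  have hkd : k / Q = k1 := by rw [hk1]; exact Nat.mul_div_cancel_left _ hQpos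
  have hld : ℓ / Q = l1 := by rw [hl1]; exact Nat.mul_div_cancel_left _ hQpos
  rw [hkd, hld] at hcQ
  rw [hkd, hld]
  have hk1pos : 0 < k1 := Nat.pos_of_ne_zero (by rintro rfl; omega)
  have hl1pos : 0 < l1 := Nat.pos_of_ne_zero (by rintro rfl; omega)
  have hkC : (k : ℂ) ≠ 0 := by exact_mod_cast hk.ne'
  have hk1C : (k1 : ℂ) ≠ 0 := by exact_mod_cast hk1pos.ne'
  have hl1C : (l1 : ℂ) ≠ 0 := by exact_mod_cast hl1pos.ne'
  have hQC : (Q : ℂ) ≠ 0 := by exact_mod_cast hQpos.ne'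
  have hℓC : (ℓ : ℂ) ≠ 0 := by exact_mod_cast (show ℓ ≠ 0 by omega)
  have hz0 : z ≠ 0 := by rintro rfl; simp at hz
  have hkeq : (k : ℂ) = Q * k1 := by exact_mod_cast hk1
  have hleq : (ℓ : ℂ) = Q * l1 := by exact_mod_cast hl1
  have hkR : (0 : ℝ) < k := by exact_mod_cast hk
  have hlR : (0 : ℝ) < l1 := by exact_mod_cast hl1pos
  -- the two arguments for the eta transformation
  set w : ℂ := z / k with hw
  have hwre : 0 < w.re := by rw [hw, Complex.div_natCast_re]; positivity
  have hw0 : w ≠ 0 := by rintro h0; rw [h0] at hwre; simp at hwre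
  set w1 : ℂ := ((l1 : ℝ) : ℂ) * w with hw1
  have hw1re : 0 < w1.re := by rw [hw1, Complex.re_ofReal_mul]; positivity
  have hA := GE_main k hk h h' hch w hwre
  have hB := GE_main k1 hk1pos ((l1 : ℤ) * h) h_Q hcQ w1 hw1re
  have hq : ‖Complex.exp (2 * (Real.pi : ℂ) * Complex.I *
        ((h : ℂ) / k + Complex.I * z / (k : ℂ) ^ 2))‖ < 1 := by
    have him : 0 < ((h : ℂ) / k + Complex.I * z / (k : ℂ) ^ 2).im := by
      have : (h : ℂ) / k + Complex.I * z / (k : ℂ) ^ 2 = (h + I * w) / k := by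
        rw [hw]; field_simp
      rw [this, Complex.div_natCast_im]
      simp only [add_im, natCast_im, zero_add, I_mul_im]
      positivity
    exact UpperHalfPlane.norm_exp_two_pi_I_lt_one ⟨_, him⟩
  rw [Rgen_eq r ℓ hℓ _ hq, ← Complex.exp_nat_mul]
  have t1 : fEuler (Complex.exp (2 * (Real.pi : ℂ) * Complex.I *
        ((h : ℂ) / k + Complex.I * z / (k : ℂ) ^ 2))) = GE ((((h : ℕ) : ℤ) + I * w) / k) := by
    unfold GE; congr 2; rw [hw]; push_cast; field_simp
  have t2 : fEuler (Complex.exp (ℓ * (2 * (Real.pi : ℂ) * Complex.I *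
        ((h : ℂ) / k + Complex.I * z / (k : ℂ) ^ 2)))) =
      GE (((((l1 : ℤ) * h : ℤ) : ℂ) + I * w1) / k1) := by
    unfold GE; congr 2; rw [hw1, hw, hkeq, hleq]; push_cast; field_simp
  have t3 : fEuler (Complex.exp (2 * (Real.pi : ℂ) * Complex.I *
            ((h' : ℂ) / k + Complex.I / z))) = GE ((h' + I / w) / k) := by
    unfold GE; congr 2; rw [hw]; field_simp
  have t4 : fEuler (Complex.exp (2 * (Real.pi : ℂ) * Complex.I * (Q : ℂ) *
            ((h_Q : ℂ) / k + Complex.I * Q / ((ℓ : ℂ) * z)))) = GE ((h_Q + I / w1) / k1) := by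
    unfold GE; congr 2; rw [hw1, hw, hkeq, hleq]; push_cast; field_simp
  rw [t1, t2, t3, t4, hA, hB]
  have hlogw1 : log w1 = (Real.log l1 : ℝ) + log w := by
    rw [hw1]; exact Complex.log_ofReal_mul hlR hw0
  have hQl : (Q : ℂ) / ℓ = (((l1 : ℝ)⁻¹ : ℝ) : ℂ) := by
    rw [hleq]; push_cast; field_simp
  have hpow : ((Q : ℂ) / ℓ) ^ ((r : ℂ) / 2) = cexp (r * (-(Real.log l1 : ℝ) / 2)) := by
    rw [Complex.cpow_def_of_ne_zero (div_ne_zero hQC hℓC), hQl, ← Complex.ofReal_log (by positivity),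
      Real.log_inv]
    congr 1; push_cast; ring
  rw [hpow, mul_div_mul_comm, ← Complex.exp_sub, mul_pow, div_pow, ← Complex.exp_nat_mul,
    ← Complex.exp_add, mul_div_assoc]
  congr 2
  rw [hlogw1, hw1, hw, hkeq, hleq]
  push_cast
  field_simp
  ring
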